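/- If a clause C is super-blocked in a formula F, then C is semantically blocked in F. -/

import Mathlib

abbrev Var := ℕ
abbrev Lit := Var × Bool
abbrev Clause := Finset Lit
abbrev Formula := Set Clause

def Lit.compl (l : Lit) : Lit := (l.1, !l.2)

def Clause.isTaut (C : Clause) : Prop := ∃ l ∈ C, Lit.compl l ∈ C

abbrev Assign := Var → Bool

def litSat (τ : Assign) (l : Lit) : Prop := τ l.1 = l.2
def clauseSat (τ : Assign) (C : Clause) : Prop := ∃ l ∈ C, litSat τ l
def formulaSat (τ : Assign) (F : Formula) : Prop := ∀ C ∈ F, clauseSat τ C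
def satisfiable (F : Formula) : Prop := ∃ τ : Assign, formulaSat τ F
def satEquiv (F G : Formula) : Prop := satisfiable F ↔ satisfiable G
def redundant (F : Formula) (C : Clause) : Prop := satEquiv (F \ {C}) (F ∪ {C})

def env (F : Formula) (C : Clause) : Formula := {D ∈ F | ∃ l ∈ D, Lit.compl l ∈ C}
def clauseVars (C : Clause) : Set Var := {v | ∃ l ∈ C, l.1 = v}
def formulaVars (F : Formula) : Set Var := {v | ∃ D ∈ F, ∃ l ∈ D, l.1 = v}
def extVars (F : Formula) (C : Clause) : Set Var := formulaVars (env F C) \ clauseVars C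

def semBlocked (F : Formula) (C : Clause) : Prop :=
  ∀ τ : Assign, formulaSat τ (env F C) →
    ∃ τ' : Assign, formulaSat τ' (env F C ∪ {C}) ∧ ∀ v : Var, v ∉ clauseVars C → τ v = τ' v

def blocksLit (F : Formula) (C : Clause) (l : Lit) : Prop :=
  l ∈ C ∧ ∀ D ∈ F, Lit.compl l ∈ D → Clause.isTaut (C ∪ D.erase (Lit.compl l))
def litBlocked (F : Formula) (C : Clause) : Prop := ∃ l : Lit, blocksLit F C l

def complSet (L : Finset Lit) : Finset Lit := L.image Lit.compl
def blocksSet (F : Formula) (C : Clause) (L : Finset Lit) : Prop :=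
  L.Nonempty ∧ L ⊆ C ∧
    ∀ D ∈ F, (D ∩ complSet L).Nonempty → Clause.isTaut ((C \ L) ∪ complSet L ∪ D)
def setBlocked (F : Formula) (C : Clause) : Prop := ∃ L : Finset Lit, blocksSet F C L

abbrev PAssign := Var → Option Bool
def pdom (σ : PAssign) : Set Var := {v | σ v ≠ none}
def plitSat (σ : PAssign) (l : Lit) : Prop := σ l.1 = some l.2
def pclauseSat (σ : PAssign) (C : Clause) : Prop := ∃ l ∈ C, plitSat σ l
def pformulaSat (σ : PAssign) (F : Formula) : Prop := ∀ C ∈ F, pclauseSat σ C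
def restrictF (F : Formula) (σ : PAssign) : Formula := {D ∈ F | ¬ pclauseSat σ D}
def punion (σ₁ σ₂ : PAssign) : PAssign := fun v => (σ₁ v).orElse (fun _ => σ₂ v)

def superBlocked (F : Formula) (C : Clause) : Prop :=
  ∀ σ : PAssign, pdom σ = extVars F C → setBlocked (restrictF F σ) C

def litClauses (F : Formula) (l : Lit) : Formula := {D ∈ F | l ∈ D}
def resolvents (F : Formula) (x : Var) : Formula :=
  {R | ∃ C ∈ litClauses F (x, true), ∃ D ∈ litClauses F (x, false),
    R = C.erase (x, true) ∪ D.erase (x, false) ∧ ¬ Clause.isTaut R}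
def elimVar (F : Formula) (x : Var) : Formula :=
  (F \ (litClauses F (x, true) ∪ litClauses F (x, false))) ∪ resolvents F x

def asymLit (F : Formula) (C : Clause) (l : Lit) : Prop :=
  ∃ D : Clause, D ⊆ C ∧ insert (Lit.compl l) D ∈ F \ {C}
def asymTaut (F : Formula) (C : Clause) : Prop :=
  ∃ ls : List Lit, Clause.isTaut (C ∪ ls.toFinset) ∧
    ∀ i : Fin ls.length, asymLit F (C ∪ (ls.take i.val).toFinset) (ls.get i)
def ratPair (F : Formula) (C : Clause) : Prop :=
  asymTaut F C ∨
    ∃ l ∈ C, ∀ D ∈ F, Lit.compl l ∈ D → asymTaut F (C ∪ D.erase (Lit.compl l))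

theorem litSat_compl_iff (τ : Assign) (l : Lit) : litSat τ (Lit.compl l) ↔ ¬ litSat τ l := by
  simp [litSat, Lit.compl, Bool.eq_not]

theorem Lit.compl_compl (l : Lit) : Lit.compl (Lit.compl l) = l := by
  simp [Lit.compl]

theorem Lit.eq_or_eq_compl {l m : Lit} (h : l.1 = m.1) : l = m ∨ l = Lit.compl m := by
  obtain ⟨v, b⟩ := l
  obtain ⟨w, c⟩ := m
  cases b <;> cases c <;> simp_all [Lit.compl]

theorem mem_complSet {L : Finset Lit} {l : Lit} : l ∈ complSet L ↔ Lit.compl l ∈ L := by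
  constructor
  · intro h
    obtain ⟨m, hm, rfl⟩ := Finset.mem_image.mp h
    rwa [Lit.compl_compl]
  · intro h
    exact Finset.mem_image.mpr ⟨_, h, Lit.compl_compl l⟩

theorem clauseSat_of_isTaut_union {τ : Assign} {A D : Clause} (hA : ¬ clauseSat τ A)
    (h : Clause.isTaut (A ∪ D)) : clauseSat τ D := by
  have hsat : clauseSat τ (A ∪ D) := by
    obtain ⟨l, hl, hlc⟩ := h
    by_cases hs : litSat τ l
    · exact ⟨l, hl, hs⟩
    · exact ⟨_, hlc, (litSat_compl_iff τ l).mpr hs⟩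
  obtain ⟨l, hl, hs⟩ := hsat
  rcases Finset.mem_union.mp hl with hl | hl
  · exact absurd ⟨l, hl, hs⟩ hA
  · exact ⟨l, hl, hs⟩

/-- Making all literals of a blocking set true preserves satisfaction of every clause. -/
theorem clauseSat_of_blocksSet {F : Formula} {C D : Clause} {L : Finset Lit} {τ τ' : Assign}
    (hL : blocksSet F C L) (hC : ¬ clauseSat τ C) (hlit : ∀ l ∈ L, litSat τ' l)
    (hvar : ∀ v, v ∉ clauseVars L → τ v = τ' v) (hD : D ∈ F) (hs : clauseSat τ D) :
    clauseSat τ' D := by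
  obtain ⟨-, hLC, hblock⟩ := hL
  by_cases hne : (D ∩ complSet L).Nonempty
  · refine clauseSat_of_isTaut_union ?_ (hblock D hD hne)
    rintro ⟨l, hl, hls⟩
    rcases Finset.mem_union.mp hl with hl | hl
    · obtain ⟨hl, hlL⟩ := Finset.mem_sdiff.mp hl
      have hlC : ¬ litSat τ l := fun h => hC ⟨l, hl, h⟩
      by_cases hv : l.1 ∈ clauseVars L
      · obtain ⟨m, hm, hml⟩ := hv
        rcases Lit.eq_or_eq_compl hml with rfl | rfl
        · exact hlL hm
        · exact hC ⟨_, hLC hm, (litSat_compl_iff τ l).mpr hlC⟩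
      · exact hlC ((hvar _ hv).trans hls)
    · exact (litSat_compl_iff τ' l).mp (hlit _ (mem_complSet.mp hl)) hls
  · obtain ⟨l, hl, hls⟩ := hs
    refine ⟨l, hl, ?_⟩
    by_cases hv : l.1 ∈ clauseVars L
    · obtain ⟨m, hm, hml⟩ := hv
      rcases Lit.eq_or_eq_compl hml with rfl | rfl
      · exact hlit _ hm
      · exact absurd ⟨l, Finset.mem_inter.mpr ⟨hl, mem_complSet.mpr hm⟩⟩ hne
    · exact (hvar _ hv).symm.trans hls

theorem superBlocked_semBlocked (F : Formula) (C : Clause) (h : superBlocked F C) :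
    semBlocked F C := by
  classical
  intro τ hτ
  by_cases hC : clauseSat τ C
  · refine ⟨τ, ?_, fun _ _ => rfl⟩
    rintro D (hD | rfl)
    · exact hτ D hD
    · exact hC
  let σ : PAssign := fun v => if v ∈ extVars F C then some (τ v) else none
  have hσ : pdom σ = extVars F C := by
    ext v
    simp [pdom, σ]
  obtain ⟨L, hL⟩ := h σ hσ
  have hLC := hL.2.1
  let τ' : Assign := fun v => if v ∈ clauseVars L then !τ v else τ v
  have hlit : ∀ l ∈ L, litSat τ' l := by
    intro l hl
    have hn : ¬ τ l.1 = l.2 := fun e => hC ⟨l, hLC hl, e⟩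
    have hv : l.1 ∈ clauseVars L := ⟨l, hl, rfl⟩
    simpa [litSat, τ', hv, Bool.eq_not] using hn
  have hvar : ∀ v, v ∉ clauseVars L → τ v = τ' v := fun v hv => by simp [τ', hv]
  have hvarC : ∀ v, v ∉ clauseVars C → τ v = τ' v := by
    refine fun v hv => hvar v ?_
    rintro ⟨l, hl, e⟩
    exact hv ⟨l, hLC hl, e⟩
  refine ⟨τ', ?_, hvarC⟩
  rintro D (hD | rfl)
  · by_cases hp : pclauseSat σ D
    · obtain ⟨l, hl, hls⟩ := hp
      refine ⟨l, hl, ?_⟩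
      have hx : l.1 ∈ extVars F C ∧ τ l.1 = l.2 := by simpa [plitSat, σ] using hls
      exact (hvarC _ hx.1.2).symm.trans hx.2
    · exact clauseSat_of_blocksSet hL hC hlit hvar ⟨hD.1, hp⟩ (hτ D hD)
  · obtain ⟨l, hl⟩ := hL.1
    exact ⟨l, hLC hl, hlit l hl⟩
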